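/- arXiv:1811.11444 — 2 statements merged into one kernel-verified Lean document; each statement's English description precedes it below -/
import Mathlib

section
/- For every integer n ≥ 14, letting h ≥ 3 be the unique integer with 2f_h − 1 ≤ n < 2f_{h+1} − 1, the number of distinct cubes www (w a nonempty word) occurring as factors of the prefix F[1,n] of the Fibonacci word equals max{n − f_{h+1} − f_{h−1} − h + 1, f_{h−1} − h}. -/
/-- Fibonacci numbers: `fn 0 = 1`, `fn 1 = 2`, `fn (m+2) = fn (m+1) + fn m`
(so `fn m` is the paper's `f_m`; also `f_{m-1} = Nat.fib (m+1)` etc.). -/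
def fn (m : ℕ) : ℕ := Nat.fib (m + 2)

/-- Finite Fibonacci words `Fw m = σ^m(a)` for the morphism σ(a)=ab, σ(b)=a,
with `a := false`, `b := true`; equivalently `Fw (m+2) = Fw (m+1) ++ Fw m`. -/
def Fw : ℕ → List Bool
  | 0 => [false]
  | 1 => [false, true]
  | m + 2 => Fw (m + 1) ++ Fw m

/-- The infinite Fibonacci word (0-indexed): the fixed point of σ beginning with `a`. -/
def fibWord (i : ℕ) : Bool := (Fw (i + 1)).getD i false

/-- `fFactor i n = F[i;n]`, the factor of length `n` of the Fibonacci word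
beginning at (1-indexed) position `i`. -/
def fFactor (i n : ℕ) : List Bool := (List.range n).map fun t => fibWord (i - 1 + t)

/-- `w` occurs as a factor of the infinite Fibonacci word. -/
def IsFactorF (w : List Bool) : Prop := ∃ i : ℕ, 1 ≤ i ∧ w = fFactor i w.length

/-- `D2 i n`: the number of distinct squares occurring as factors of `F[i;n]`. -/
noncomputable def D2 (i n : ℕ) : ℕ :=
  {w : List Bool | w ≠ [] ∧ (w ++ w) <:+: fFactor i n}.ncard

/-- `D3 i n`: the number of distinct cubes `www` occurring as factors of `F[i;n]`. -/
noncomputable def D3 (i n : ℕ) : ℕ :=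
  {w : List Bool | w ≠ [] ∧ (w ++ w ++ w) <:+: fFactor i n}.ncard


theorem Fw_length (m : ℕ) : (Fw m).length = Nat.fib (m + 2) := by
  induction m using Nat.strong_induction_on with
  | _ m ih =>
    match m with
    | 0 => rfl
    | 1 => rfl
    | m + 2 =>
      rw [Fw, List.length_append, ih (m + 1) (by omega), ih m (by omega),
        Nat.fib_add_two (n := m + 2)]
      ring

theorem Fw_pre_succ (m : ℕ) : Fw m <+: Fw (m + 1) := by
  match m with
  | 0 => exact ⟨[true], rfl⟩
  | m + 1 => exact ⟨Fw m, rfl⟩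

theorem Fw_pre {m k : ℕ} (hmk : m ≤ k) : Fw m <+: Fw k := by
  induction k, hmk using Nat.le_induction with
  | base => exact List.prefix_rfl
  | succ k _ ih => exact ih.trans (Fw_pre_succ k)

theorem pre_getD {l l' : List Bool} (hl : l <+: l') {i : ℕ} (hi : i < l.length) :
    l'.getD i false = l.getD i false := by
  obtain ⟨s, rfl⟩ := hl
  exact List.getD_append _ _ _ _ hi

theorem lt_fib_add_three (i : ℕ) : i < Nat.fib (i + 3) := by
  induction i with
  | zero => decide
  | succ i ih =>
    have := Nat.fib_add_two (n := i + 2)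
    have h2 : 0 < Nat.fib (i + 2) := Nat.fib_pos.2 (by omega)
    simp only [Nat.add_assoc, Nat.reduceAdd] at *
    omega

theorem Fw_getD {m i : ℕ} (hi : i < Nat.fib (m + 2)) : (Fw m).getD i false = fibWord i := by
  unfold fibWord
  have hi2 : i < (Fw (i + 1)).length := by
    rw [Fw_length]; exact lt_fib_add_three i
  have hi1 : i < (Fw m).length := by rw [Fw_length]; exact hi
  rcases le_total m (i + 1) with hh | hh
  · exact (pre_getD (Fw_pre hh) hi1).symm
  · exact pre_getD (Fw_pre hh) hi2

/-- (A): the word repeats its own prefix. -/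
theorem fw_shift {m t : ℕ} (ht : t < Nat.fib (m + 2)) :
    fibWord (Nat.fib (m + 3) + t) = fibWord t := by
  have hf := Nat.fib_add_two (n := m + 2)
  have h1 : Nat.fib (m + 3) + t < Nat.fib (m + 2 + 2) := by
    simp only [Nat.add_assoc, Nat.reduceAdd] at *
    omega
  rw [← Fw_getD h1, ← Fw_getD ht, Fw]
  rw [List.getD_append_right _ _ _ _ (by rw [Fw_length]; simp)]
  rw [Fw_length]
  simp

/-- (C): comparison of the word with its shift by a Fibonacci number, first block. -/
theorem fw_near_comm (m : ℕ) : ∀ t < Nat.fib (m + 3),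
    (fibWord (Nat.fib (m + 2) + t) ≠ fibWord t ↔ Nat.fib (m + 3) ≤ t + 2) := by
  induction m with
  | zero => decide
  | succ m ih =>
    intro t ht
    have e1 := Nat.fib_add_two (n := m + 2)
    have e2 := Nat.fib_add_two (n := m + 1)
    have hp : 2 ≤ Nat.fib (m + 3) := by
      have : 0 < Nat.fib (m + 1) := Nat.fib_pos.2 (by omega)
      have : 0 < Nat.fib (m + 2) := Nat.fib_pos.2 (by omega)
      simp only [Nat.add_assoc, Nat.reduceAdd] at *
      omega
    simp only [Nat.add_assoc, Nat.reduceAdd] at *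
    by_cases hlt : t < Nat.fib (m + 2)
    · rw [fw_shift hlt]
      simp; omega
    · obtain ⟨u, rfl⟩ := Nat.exists_eq_add_of_le (not_lt.1 hlt)
      have hu : u < Nat.fib (m + 3) := by omega
      have := ih u hu
      have e3 : Nat.fib (m + 3) + (Nat.fib (m + 2) + u) = Nat.fib (m + 1 + 3) + u := by
        show _ = Nat.fib (m + 4) + u
        omega
      rw [e3, fw_shift (m := m + 1) hu]
      rw [ne_comm, this]
      omega

theorem exists_fib_between {k : ℕ} (hk : 1 ≤ k) :
    ∃ m, Nat.fib (m + 2) ≤ k ∧ k < Nat.fib (m + 3) := by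
  have hex : ∃ m, k < Nat.fib (m + 3) := ⟨k, lt_fib_add_three k⟩
  classical
  refine ⟨Nat.find hex, ?_, Nat.find_spec hex⟩
  rcases Nat.eq_zero_or_pos (Nat.find hex) with h0 | h0
  · rw [h0]; simpa using hk
  · have := Nat.find_min hex (m := Nat.find hex - 1) (by omega)
    have e : Nat.find hex - 1 + 3 = Nat.find hex + 2 := by omega
    rw [e] at this
    omega

/-- Decomposition used for strong induction. -/
theorem decomp {k : ℕ} (hk : 2 ≤ k) : ∃ m t, t < Nat.fib (m + 2) ∧ k = Nat.fib (m + 3) + t := by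
  obtain ⟨m, h1, h2⟩ := exists_fib_between (k := k) (by omega)
  match m with
  | 0 => norm_num [Nat.fib] at h2; omega
  | m + 1 =>
    have e1 := Nat.fib_add_two (n := m + 2)
    simp only [Nat.add_assoc, Nat.reduceAdd] at *
    exact ⟨m, k - Nat.fib (m + 3), by omega, by omega⟩

theorem no_bb (k : ℕ) (hk : fibWord k = true) : fibWord (k + 1) = false := by
  induction k using Nat.strong_induction_on with
  | _ k ih =>
    by_cases h2 : 2 ≤ k
    · obtain ⟨m, t, ht, rfl⟩ := decomp h2
      rw [fw_shift ht] at hk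
      have e1 := Nat.fib_add_two (n := m + 2)
      have hpos : 0 < Nat.fib (m + 3) := Nat.fib_pos.2 (by omega)
      by_cases ht1 : t + 1 < Nat.fib (m + 2)
      · rw [Nat.add_assoc, fw_shift ht1]
        exact ih t (by omega) hk
      · have e : Nat.fib (m + 3) + t + 1 = Nat.fib (m + 1 + 3) + 0 := by
          show _ = Nat.fib (m + 4) + 0
          simp only [Nat.add_assoc, Nat.reduceAdd] at *
          omega
        rw [e, fw_shift (m := m + 1) hpos]
        rfl
    · interval_cases k
      · exact absurd hk (by decide)
      · decide

/-- length of the image of a letter under `σ^m` -/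
def bl (m : ℕ) (c : Bool) : ℕ := if c then Nat.fib (m + 1) else Nat.fib (m + 2)

/-- starting position of the `k`-th block of level `m` -/
def bs (m k : ℕ) : ℕ := ∑ j ∈ Finset.range k, bl m (fibWord j)

theorem bs_zero (m : ℕ) : bs m 0 = 0 := rfl

theorem bs_succ (m k : ℕ) : bs m (k + 1) = bs m k + bl m (fibWord k) := Finset.sum_range_succ _ _

theorem bl_pos (m : ℕ) (c : Bool) : 0 < bl m c := by
  unfold bl
  split <;> exact Nat.fib_pos.2 (by omega)

theorem bs_add {m j t : ℕ} (ht : t ≤ Nat.fib (j + 2)) :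
    bs m (Nat.fib (j + 3) + t) = bs m (Nat.fib (j + 3)) + bs m t := by
  induction t with
  | zero => rfl
  | succ t ih =>
    rw [← Nat.add_assoc, bs_succ, bs_succ, ih (by omega), fw_shift (by omega), Nat.add_assoc]

theorem bs_fib (m j : ℕ) : bs m (Nat.fib (j + 2)) = Nat.fib (m + j + 2) := by
  induction j using Nat.strong_induction_on with
  | _ j ih =>
    match j with
    | 0 => simp [bs, bl, show fibWord 0 = false from rfl]
    | 1 =>
      have e1 := Nat.fib_add_two (n := m + 1)
      have : Nat.fib (1 + 2) = 2 := rfl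
      rw [this]
      simp [bs, bl, Finset.sum_range_succ, show fibWord 0 = false from rfl,
        show fibWord 1 = true from rfl]
      simp only [Nat.add_assoc, Nat.reduceAdd] at *
      omega
    | j + 2 =>
      have e1 := Nat.fib_add_two (n := j + 2)
      have e2 := Nat.fib_add_two (n := m + j + 2)
      have i1 := ih (j + 1) (by omega)
      have i2 := ih j (by omega)
      have e : Nat.fib (j + 2 + 2) = Nat.fib (j + 3) + Nat.fib (j + 2) := by
        rw [e1, Nat.add_comm]
      rw [e, bs_add le_rfl, i2]
      rw [show m + (j + 2) + 2 = m + j + 2 + 2 by ring, e2]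
      rw [show j + 3 = j + 1 + 2 by ring, i1]
      rw [show m + (j + 1) + 2 = m + j + 2 + 1 by ring]
      ring

theorem bs_mono (m : ℕ) : StrictMono (bs m) := by
  refine strictMono_nat_of_lt_succ fun k => ?_
  rw [bs_succ]
  have := bl_pos m (fibWord k)
  omega

/-- (B): every block is a prefix of the word. -/
theorem block_pre (m k : ℕ) : ∀ t < bl (m + 1) (fibWord k),
    fibWord (bs (m + 1) k + t) = fibWord t := by
  induction k using Nat.strong_induction_on with
  | _ k ih =>
    intro t ht
    by_cases h2 : 2 ≤ k
    · obtain ⟨j, u, hu, rfl⟩ := decomp h2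
      rw [fw_shift hu] at ht
      have hpos : 0 < Nat.fib (j + 3) := Nat.fib_pos.2 (by omega)
      have hb := bs_fib (m + 1) (j + 1)
      have hlt : bs (m + 1) u + t < Nat.fib (m + 1 + j + 2) := by
        rw [← bs_fib]
        have := (bs_mono (m + 1)).monotone (show u + 1 ≤ Nat.fib (j + 2) from hu)
        rw [bs_succ] at this
        omega
      rw [bs_add hu.le, show j + 3 = j + 1 + 2 by ring, hb, Nat.add_assoc,
        show m + 1 + (j + 1) + 2 = m + 1 + j + 3 by ring, fw_shift hlt]
      exact ih u (by omega) t ht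
    · interval_cases k
      · rw [bs_zero, Nat.zero_add]
      · have hb := bs_fib (m + 1) 0
        rw [show Nat.fib (0 + 2) = 1 from rfl] at hb
        rw [hb]
        exact fw_shift (m := m) ht

theorem bl_true (m : ℕ) : bl m true = Nat.fib (m + 1) := rfl
theorem bl_false (m : ℕ) : bl m false = Nat.fib (m + 2) := rfl

theorem fib_le_bl (m : ℕ) (c : Bool) : Nat.fib (m + 1) ≤ bl m c := by
  cases c
  · exact Nat.fib_mono (by omega)
  · exact le_rfl

/-- around an `a`-block -/
theorem block_pre_a {m k : ℕ} (hk : fibWord k = false) {t : ℕ} (ht : t < Nat.fib (m + 4)) :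
    fibWord (bs (m + 1) k + t) = fibWord t := by
  have e1 := Nat.fib_add_two (n := m + 2)
  simp only [Nat.add_assoc, Nat.reduceAdd] at *
  by_cases hlt : t < Nat.fib (m + 3)
  · exact block_pre m k t (by rw [hk]; exact hlt)
  · obtain ⟨u, rfl⟩ := Nat.exists_eq_add_of_le (not_lt.1 hlt)
    have hu : u < Nat.fib (m + 2) := by omega
    rw [fw_shift hu]
    have := block_pre m (k + 1) u (lt_of_lt_of_le hu (fib_le_bl (m + 1) _))
    rw [bs_succ, hk, bl_false, Nat.add_assoc] at this
    exact this

theorem mis_a {r k : ℕ} (hk : fibWord k = false) {t : ℕ} (ht : t < Nat.fib (r + 3)) :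
    fibWord (bs (r + 1) k + t + Nat.fib (r + 2)) ≠ fibWord (bs (r + 1) k + t) ↔
      Nat.fib (r + 3) ≤ t + 2 := by
  have e1 := Nat.fib_add_two (n := r + 2)
  simp only [Nat.add_assoc, Nat.reduceAdd] at *
  have e2 := block_pre_a (m := r) hk (t := t) (by omega)
  have e3 := block_pre_a (m := r) hk (t := t + Nat.fib (r + 2)) (by omega)
  rw [e2, e3, Nat.add_comm t]
  exact fw_near_comm r t ht

theorem bs_succ_b {r k : ℕ} (hk : fibWord k = true) :
    bs (r + 1) (k + 1) = bs (r + 1) k + Nat.fib (r + 2) := by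
  rw [bs_succ, hk, bl_true]

theorem bs_succ_a {r k : ℕ} (hk : fibWord k = false) :
    bs (r + 1) (k + 1) = bs (r + 1) k + Nat.fib (r + 3) := by
  rw [bs_succ, hk, bl_false]

theorem mis_b {r k : ℕ} (hk : fibWord k = true) {t : ℕ} (ht : t < Nat.fib (r + 2)) :
    fibWord (bs (r + 1) k + t + Nat.fib (r + 2)) = fibWord (bs (r + 1) k + t) := by
  have e2 := block_pre r k t (by rw [hk]; exact ht)
  have e3 := block_pre r (k + 1) t (lt_of_lt_of_le ht (fib_le_bl (r + 1) _))
  rw [bs_succ_b hk] at e3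
  rw [e2, ← e3]
  congr 1
  ring

theorem exists_block (m i : ℕ) : ∃ k t, t < bl m (fibWord k) ∧ i = bs m k + t := by
  induction i with
  | zero => exact ⟨0, 0, bl_pos _ _, rfl⟩
  | succ i ih =>
    obtain ⟨k, t, ht, rfl⟩ := ih
    by_cases h : t + 1 < bl m (fibWord k)
    · exact ⟨k, t + 1, h, rfl⟩
    · refine ⟨k + 1, 0, bl_pos _ _, ?_⟩
      rw [bs_succ]
      omega

theorem fib_bounds (r : ℕ) : 2 ≤ Nat.fib (r + 3) ∧ 1 ≤ Nat.fib (r + 2) ∧ 1 ≤ Nat.fib (r + 1) ∧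
    Nat.fib (r + 3) = Nat.fib (r + 1) + Nat.fib (r + 2) ∧
    Nat.fib (r + 4) = Nat.fib (r + 2) + Nat.fib (r + 3) ∧ Nat.fib (r + 1) ≤ Nat.fib (r + 2) := by
  have h1 : 0 < Nat.fib (r + 1) := Nat.fib_pos.2 (by omega)
  have h2 : 0 < Nat.fib (r + 2) := Nat.fib_pos.2 (by omega)
  have e1 := Nat.fib_add_two (n := r + 1)
  have e2 := Nat.fib_add_two (n := r + 2)
  have h3 : Nat.fib (r + 1) ≤ Nat.fib (r + 2) := Nat.fib_mono (by omega)
  simp only [Nat.add_assoc, Nat.reduceAdd] at *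
  omega

/-- every window of length `f_{r+2} - 1` has a mismatch for the shift by `f_r`. -/
theorem exists_mis (r i : ℕ) : ∃ x, i ≤ x ∧ x + 2 ≤ i + Nat.fib (r + 4) ∧
    fibWord (x + Nat.fib (r + 2)) ≠ fibWord x := by
  obtain ⟨h1, h2, h3, h4, h5, h6⟩ := fib_bounds r
  obtain ⟨k, t, ht, rfl⟩ := exists_block (r + 1) i
  cases hk : fibWord k
  · rw [hk, bl_false] at ht
    simp only [Nat.add_assoc, Nat.reduceAdd] at *
    refine ⟨bs (r + 1) k + (Nat.fib (r + 3) - 1), by omega, by omega, ?_⟩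
    exact (mis_a hk (by omega)).2 (by omega)
  · rw [hk, bl_true] at ht
    simp only [Nat.add_assoc, Nat.reduceAdd] at *
    have hs := bs_succ_b (r := r) hk
    refine ⟨bs (r + 1) (k + 1) + (Nat.fib (r + 3) - 2), by omega, by omega, ?_⟩
    exact (mis_a (no_bb k hk) (by omega)).2 (by omega)

theorem last_two (m : ℕ) : ∃ u, u + 2 = Nat.fib (m + 3) ∧ fibWord u ≠ fibWord (u + 1) := by
  induction m using Nat.strong_induction_on with
  | _ m ih =>
    match m with
    | 0 => exact ⟨0, by decide, by decide⟩
    | 1 => exact ⟨1, by decide, by decide⟩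
    | m + 2 =>
      obtain ⟨u, hu, hne⟩ := ih m (by omega)
      have e := Nat.fib_add_two (n := m + 3)
      refine ⟨Nat.fib (m + 4) + u, ?_, ?_⟩
      · simp only [Nat.add_assoc, Nat.reduceAdd] at *
        omega
      · have a1 := fw_shift (m := m + 1) (t := u) (by show u < Nat.fib (m + 3); omega)
        have a2 := fw_shift (m := m + 1) (t := u + 1) (by show u + 1 < Nat.fib (m + 3); omega)
        simp only [Nat.add_assoc, Nat.reduceAdd] at *
        rw [a1, a2]
        exact hne

theorem mis_form {r x : ℕ} (hx : fibWord (x + Nat.fib (r + 2)) ≠ fibWord x) :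
    ∃ k t, fibWord k = false ∧ x = bs (r + 1) k + t ∧ t < Nat.fib (r + 3) ∧
      Nat.fib (r + 3) ≤ t + 2 ∧ fibWord x = fibWord t := by
  obtain ⟨k, t, ht, rfl⟩ := exists_block (r + 1) x
  cases hk : fibWord k
  · rw [hk, bl_false] at ht
    exact ⟨k, t, hk, rfl, ht, (mis_a hk ht).1 hx,
      block_pre r k t (by rw [hk]; exact ht)⟩
  · rw [hk, bl_true] at ht
    exact absurd (mis_b hk ht) hx

/-- Periods of cubes are Fibonacci numbers. -/
theorem period_fib {i p : ℕ} (hp : 0 < p)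
    (hper : ∀ j < 2 * p, fibWord (i + j) = fibWord (i + j + p)) : ∃ m, p = Nat.fib (m + 2) := by
  obtain ⟨m, hm1, hm2⟩ := exists_fib_between (k := p) hp
  rcases hm1.eq_or_lt with heq | hlt
  · exact ⟨m, heq.symm⟩
  exfalso
  match m with
  | 0 => norm_num [Nat.fib] at hm2 hlt; omega
  | r + 1 =>
    obtain ⟨h1, h2, h3, h4, h5, h6⟩ := fib_bounds r
    simp only [Nat.add_assoc, Nat.reduceAdd] at hlt hm2
    obtain ⟨x, hx1, hx2, hx⟩ := exists_mis r i
    have hy : ∃ y, i ≤ y ∧ y + Nat.fib (r + 2) < i + 2 * p ∧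
        fibWord (y + Nat.fib (r + 2)) ≠ fibWord y ∧
        fibWord (y + p + Nat.fib (r + 2)) ≠ fibWord (y + p) := by
      by_cases hc : i + p ≤ x
      · refine ⟨x - p, by omega, by omega, ?_, ?_⟩
        · have p1 := hper (x - p - i) (by omega)
          have p2 := hper (x - p - i + Nat.fib (r + 2)) (by omega)
          rw [show i + (x - p - i) = x - p by omega, show x - p + p = x by omega] at p1
          rw [show i + (x - p - i + Nat.fib (r + 2)) = x - p + Nat.fib (r + 2) by omega,
            show x - p + Nat.fib (r + 2) + p = x + Nat.fib (r + 2) by omega] at p2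
          rw [p1, p2]; exact hx
        · rw [show x - p + p = x by omega]; exact hx
      · refine ⟨x, hx1, by omega, hx, ?_⟩
        have p1 := hper (x - i) (by omega)
        have p2 := hper (x - i + Nat.fib (r + 2)) (by omega)
        rw [show i + (x - i) = x by omega] at p1
        rw [show i + (x - i + Nat.fib (r + 2)) = x + Nat.fib (r + 2) by omega,
            show x + Nat.fib (r + 2) + p = x + p + Nat.fib (r + 2) by omega] at p2
        rw [← p1, ← p2]; exact hx
    obtain ⟨y, hy1, hy2, hy3, hy4⟩ := hy
    have hyp := hper (y - i) (by omega)
    rw [show i + (y - i) = y by omega] at hyp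
    obtain ⟨k, t, hk, e, ht1, ht2, ht3⟩ := mis_form hy3
    obtain ⟨k', t', hk', e', ht1', ht2', ht3'⟩ := mis_form hy4
    obtain ⟨u, hu, hne⟩ := last_two r
    have htt : t = t' := by
      have hFt : fibWord t = fibWord t' := by rw [← ht3, ← ht3', hyp]
      have c1 : t = u ∨ t = u + 1 := by omega
      have c2 : t' = u ∨ t' = u + 1 := by omega
      rcases c1 with rfl | rfl <;> rcases c2 with rfl | rfl
      · rfl
      · exact absurd hFt hne
      · exact absurd hFt.symm hne
      · rfl
    have hd : bs (r + 1) k' = bs (r + 1) k + p := by omega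
    have hs := bs_succ_a (r := r) hk
    rcases lt_trichotomy k' (k + 1) with hlt1 | heq1 | hgt1
    · have := (bs_mono (r + 1)).monotone (show k' ≤ k by omega)
      omega
    · rw [heq1] at hd
      omega
    · have hm := (bs_mono (r + 1)).monotone (show k + 1 + 1 ≤ k' by omega)
      rw [bs_succ] at hm
      have := fib_le_bl (r + 1) (fibWord (k + 1))
      simp only [Nat.add_assoc, Nat.reduceAdd] at *
      omega

/-- A cube of period `f_m` starts in a `b`-block of level `m+1`. -/
theorem cube_pos {i m : ℕ}
    (hper : ∀ j < 2 * Nat.fib (m + 2), fibWord (i + j) = fibWord (i + j + Nat.fib (m + 2))) :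
    ∃ t, t + 2 ≤ Nat.fib (m + 1) ∧ Nat.fib (m + 3) + t ≤ i ∧
      ∀ j < Nat.fib (m + 2), fibWord (i + j) = fibWord (Nat.fib (m + 3) + t + j) := by
  obtain ⟨h1, h2, h3, h4, h5, h6⟩ := fib_bounds m
  obtain ⟨k, t, ht, rfl⟩ := exists_block (m + 1) i
  cases hk : fibWord k
  · exfalso
    rw [hk, bl_false] at ht
    simp only [Nat.add_assoc, Nat.reduceAdd] at ht
    have := (mis_a (r := m) hk (t := Nat.fib (m + 3) - 1) (by omega)).2 (by omega)
    have h := hper (Nat.fib (m + 3) - 1 - t) (by omega)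
    rw [show bs (m + 1) k + t + (Nat.fib (m + 3) - 1 - t) =
      bs (m + 1) k + (Nat.fib (m + 3) - 1) by omega] at h
    exact this h.symm
  · rw [hk, bl_true] at ht
    simp only [Nat.add_assoc, Nat.reduceAdd] at ht
    have hs := bs_succ_b (r := m) hk
    have hb1 : bs (m + 1) 1 = Nat.fib (m + 3) := bs_fib (m + 1) 0
    have hk1 : 1 ≤ k := by
      rcases Nat.eq_zero_or_pos k with rfl | h
      · exact absurd hk (by decide)
      · exact h
    have hle := (bs_mono (m + 1)).monotone hk1
    have htb : t + 2 ≤ Nat.fib (m + 1) := by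
      by_contra hcon
      have := (mis_a (r := m) (no_bb k hk) (t := Nat.fib (m + 3) - 2) (by omega)).2 (by omega)
      have h := hper (Nat.fib (m + 4) - 2 - t) (by omega)
      rw [show bs (m + 1) k + t + (Nat.fib (m + 4) - 2 - t) =
        bs (m + 1) (k + 1) + (Nat.fib (m + 3) - 2) by omega] at h
      exact this h.symm
    have key : ∀ k, fibWord k = true → ∀ j < Nat.fib (m + 2) + Nat.fib (m + 3),
        fibWord (bs (m + 1) k + j) =
        if j < Nat.fib (m + 2) then fibWord j else fibWord (j - Nat.fib (m + 2)) := by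
      intro k hk j hj
      split_ifs with hc
      · exact block_pre m k j (by rw [hk]; exact hc)
      · have := block_pre m (k + 1) (j - Nat.fib (m + 2))
          (by rw [no_bb k hk, bl_false]; simp only [Nat.add_assoc, Nat.reduceAdd]; omega)
        rw [← this, bs_succ_b hk]
        congr 1
        omega
    refine ⟨t, htb, by omega, ?_⟩
    intro j hj
    rw [← hb1, Nat.add_assoc, Nat.add_assoc, key k hk _ (by omega), key 1 rfl _ (by omega)]

theorem cube_at {m t : ℕ} (ht : t + 2 ≤ Nat.fib (m + 1)) : ∀ j < 2 * Nat.fib (m + 2),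
    fibWord (Nat.fib (m + 3) + t + j) = fibWord (Nat.fib (m + 3) + t + j + Nat.fib (m + 2)) := by
  intro j hj
  obtain ⟨h1, h2, h3, h4, h5, h6⟩ := fib_bounds m
  have hb1 : bs (m + 1) 1 = Nat.fib (m + 3) := bs_fib (m + 1) 0
  have hb2 := bs_succ_b (r := m) (k := 1) rfl
  by_cases hc : t + j < Nat.fib (m + 2)
  · have := mis_b (r := m) (k := 1) rfl hc
    rw [← hb1, Nat.add_assoc (bs _ _)]
    exact this.symm
  · have := (mis_a (r := m) (k := 2) (by decide) (t := t + j - Nat.fib (m + 2)) (by omega)).not.2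
      (by omega)
    rw [not_not] at this
    rw [show bs (m + 1) 2 + (t + j - Nat.fib (m + 2)) = Nat.fib (m + 3) + t + j by
      simp only [Nat.reduceAdd] at hb2; omega] at this
    exact this.symm

/-- Distinctness of the cubes of a given period. -/
theorem cube_inj {m t t' : ℕ} (htt : t < t') (ht' : t' + 2 ≤ Nat.fib (m + 1))
    (heq : ∀ j < Nat.fib (m + 2),
      fibWord (Nat.fib (m + 3) + t + j) = fibWord (Nat.fib (m + 3) + t' + j)) : False := by
  obtain ⟨h1, h2, h3, h4, h5, h6⟩ := fib_bounds m
  have e2 : ∀ j < 2 * Nat.fib (m + 2),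
      fibWord (Nat.fib (m + 3) + t + j) = fibWord (Nat.fib (m + 3) + t' + j) := by
    intro j hj
    by_cases hc : j < Nat.fib (m + 2)
    · exact heq j hc
    · have a1 := cube_at (m := m) (t := t) (by omega) (j - Nat.fib (m + 2)) (by omega)
      have a2 := cube_at (m := m) ht' (j - Nat.fib (m + 2)) (by omega)
      have a3 := heq (j - Nat.fib (m + 2)) (by omega)
      simp only [Nat.add_assoc] at *
      rw [show j - Nat.fib (m + 2) + Nat.fib (m + 2) = j by omega] at a1 a2
      rw [← a1, ← a2, a3]
  obtain ⟨d, rfl⟩ := Nat.exists_eq_add_of_le htt.le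
  have hper : ∀ j < 2 * Nat.fib (m + 2),
      fibWord (Nat.fib (m + 3) + t + j) = fibWord (Nat.fib (m + 3) + t + j + d) := by
    intro j hj
    rw [e2 j hj]
    congr 1
    ring
  obtain ⟨r, hr⟩ := period_fib (i := Nat.fib (m + 3) + t) (p := d) (by omega)
    (fun j hj => hper j (by omega))
  obtain ⟨x, hx1, hx2, hx⟩ := exists_mis r (Nat.fib (m + 3) + t)
  obtain ⟨g1, g2, g3, g4, g5, g6⟩ := fib_bounds r
  have hrm : r + 4 ≤ m + 2 := by
    by_contra hcon
    have := Nat.fib_mono (show m + 1 ≤ r + 2 by omega)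
    omega
  have hfm := Nat.fib_mono hrm
  have := hper (x - (Nat.fib (m + 3) + t)) (by omega)
  rw [show Nat.fib (m + 3) + t + (x - (Nat.fib (m + 3) + t)) = x by omega, hr] at this
  exact hx this.symm

theorem fFactor_length (i n : ℕ) : (fFactor i n).length = n := by simp [fFactor]

theorem fFactor_eq {i i' p : ℕ} : fFactor (i + 1) p = fFactor (i' + 1) p ↔
    ∀ j < p, fibWord (i + j) = fibWord (i' + j) := by
  simp [fFactor]

theorem fFactor_add (i p q : ℕ) :
    fFactor (i + 1) (p + q) = fFactor (i + 1) p ++ fFactor (i + p + 1) q := by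
  simp [fFactor, List.range_add, Nat.add_assoc]

theorem infix_iff (l : List Bool) (n : ℕ) :
    l <:+: fFactor 1 n ↔ ∃ i, i + l.length ≤ n ∧ l = fFactor (i + 1) l.length := by
  constructor
  · rintro ⟨s, u, h⟩
    have hlen := congrArg List.length h
    simp only [List.length_append, fFactor_length] at hlen
    refine ⟨s.length, by omega, ?_⟩
    rw [← hlen, show (1 : ℕ) = 0 + 1 from rfl, fFactor_add, fFactor_add] at h
    have h1 := List.append_inj h (by simp [fFactor_length])
    have h2 := List.append_inj h1.1 (by simp [fFactor_length])
    simpa using h2.2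
  · rintro ⟨i, hi, h⟩
    obtain ⟨q, rfl⟩ := Nat.exists_eq_add_of_le hi
    refine ⟨fFactor 1 i, fFactor (i + l.length + 1) q, ?_⟩
    have := fFactor_add 0 (i + l.length) q
    rw [fFactor_add 0 i] at this
    simp only [Nat.zero_add] at this
    rw [this, ← h]

theorem cube_iff (w : List Bool) (n : ℕ) : (w ≠ [] ∧ (w ++ w ++ w) <:+: fFactor 1 n) ↔
    ∃ i p, 0 < p ∧ i + 3 * p ≤ n ∧ (∀ j < 2 * p, fibWord (i + j) = fibWord (i + j + p)) ∧
      w = fFactor (i + 1) p := by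
  rw [infix_iff]
  constructor
  · rintro ⟨hw, i, hi, h⟩
    simp only [List.length_append] at hi h
    rw [fFactor_add, fFactor_add] at h
    have h1 := List.append_inj h (by simp [fFactor_length])
    have h2 := List.append_inj h1.1 (by simp [fFactor_length])
    have a := h2.1.symm.trans h2.2
    have b := h2.2.symm.trans h1.2
    rw [fFactor_eq] at a b
    refine ⟨i, w.length, List.length_pos_iff.2 hw, by omega, ?_, h2.1⟩
    intro j hj
    by_cases hc : j < w.length
    · rw [a j hc]; congr 1; ring
    · have := b (j - w.length) (by omega)
      rw [show i + w.length + (j - w.length) = i + j by omega,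
        show i + (w.length + w.length) + (j - w.length) = i + j + w.length by omega] at this
      exact this
  · rintro ⟨i, p, hp, hi, hper, rfl⟩
    refine ⟨?_, i, by simp only [List.length_append, fFactor_length]; omega, ?_⟩
    · intro h0
      have := congrArg List.length h0
      rw [fFactor_length] at this
      simp at this
      omega
    · simp only [List.length_append, fFactor_length]
      rw [fFactor_add, fFactor_add]
      have a : fFactor (i + 1) p = fFactor (i + p + 1) p := by
        rw [fFactor_eq]
        intro j hj
        rw [hper j (by omega)]; congr 1; ring
      have b : fFactor (i + 1) p = fFactor (i + (p + p) + 1) p := by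
        rw [a, fFactor_eq]
        intro j hj
        have := hper (p + j) (by omega)
        rw [show i + p + j = i + (p + j) by ring, this]; congr 1; ring
      rw [← a, ← b]

theorem fib_add_two_inj {m m' : ℕ} (h : Nat.fib (m + 2) = Nat.fib (m' + 2)) : m = m' :=
  Nat.fib_add_two_strictMono.injective h

theorem sum_fib_sub (h : ℕ) :
    (∑ m ∈ Finset.range h, ((Nat.fib (m + 1) : ℤ) - 1)) = Nat.fib (h + 2) - 1 - h := by
  induction h with
  | zero => simp
  | succ h ih =>
    rw [Finset.sum_range_succ, ih, Nat.fib_add_two (n := h + 1)]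
    push_cast
    ring

/-- The number of distinct cubes in the prefix `F[1,n]` equals
`max (n - f_{h+1} - f_{h-1} - h + 1) (f_{h-1} - h)` where `2f_h - 1 ≤ n < 2f_{h+1} - 1`,
`n ≥ 14`, `h ≥ 3`. -/
theorem number_of_cubes_in_prefix (n h : ℕ) (hn : 14 ≤ n) (hh : 3 ≤ h)
    (h1 : (2 * fn h : ℤ) - 1 ≤ (n : ℤ)) (h2 : (n : ℤ) < 2 * fn (h + 1) - 1) :
    (D3 1 n : ℤ) =
      max ((n : ℤ) - (fn (h + 1) : ℤ) - (Nat.fib (h + 1) : ℤ) - (h : ℤ) + 1)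
        ((Nat.fib (h + 1) : ℤ) - (h : ℤ)) := by
  obtain ⟨g, rfl⟩ : ∃ g, h = g + 1 := ⟨h - 1, by omega⟩
  unfold fn at *
  simp only [Nat.add_assoc, Nat.reduceAdd] at *
  obtain ⟨b1, b2, b3, b4, b5, b6⟩ := fib_bounds g
  let T : Finset (Σ _ : ℕ, ℕ) := (Finset.range (g + 1)).sigma fun m =>
    Finset.range (if m < g then Nat.fib (m + 1) - 1
      else n + 1 - (Nat.fib (g + 3) + 3 * Nat.fib (g + 2)))
  have hT : ∀ m t, (⟨m, t⟩ : Σ _ : ℕ, ℕ) ∈ T ↔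
      t + 2 ≤ Nat.fib (m + 1) ∧ Nat.fib (m + 3) + t + 3 * Nat.fib (m + 2) ≤ n := by
    intro m t
    simp only [T, Finset.mem_sigma, Finset.mem_range]
    obtain ⟨c1, c2, c3, c4, c5, c6⟩ := fib_bounds m
    rcases lt_trichotomy m g with hm | rfl | hm
    · rw [if_pos hm]
      have i1 : Nat.fib (m + 4) ≤ Nat.fib (g + 3) := Nat.fib_mono (by omega)
      omega
    · rw [if_neg (lt_irrefl _)]
      omega
    · rw [if_neg (by omega)]
      have i1 : Nat.fib (g + 3) ≤ Nat.fib (m + 2) := Nat.fib_mono (by omega)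
      omega
  let φ : (Σ _ : ℕ, ℕ) → List Bool := fun x => fFactor (Nat.fib (x.1 + 3) + x.2 + 1) (Nat.fib (x.1 + 2))
  have hset : {w : List Bool | w ≠ [] ∧ (w ++ w ++ w) <:+: fFactor 1 n} = φ '' (T : Set (Σ _ : ℕ, ℕ)) := by
    ext w
    rw [Set.mem_ofPred_eq, cube_iff]
    constructor
    · rintro ⟨i, p, hp, hi, hper, rfl⟩
      obtain ⟨m, rfl⟩ := period_fib hp hper
      obtain ⟨t, ht1, ht2, ht3⟩ := cube_pos hper
      refine ⟨⟨m, t⟩, ?_, ?_⟩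
      · rw [Finset.mem_coe, hT]
        exact ⟨ht1, by omega⟩
      · exact (fFactor_eq.2 ht3).symm
    · rintro ⟨⟨m, t⟩, hmem, rfl⟩
      rw [Finset.mem_coe, hT] at hmem
      exact ⟨Nat.fib (m + 3) + t, Nat.fib (m + 2), Nat.fib_pos.2 (by omega), hmem.2,
        cube_at hmem.1, rfl⟩
  have hinj : Set.InjOn φ (T : Set (Σ _ : ℕ, ℕ)) := by
    rintro ⟨m, t⟩ hx ⟨m', t'⟩ hy heq
    rw [Finset.mem_coe, hT] at hx hy
    have hlen := congrArg List.length heq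
    simp only [φ, fFactor_length] at hlen
    obtain rfl := fib_add_two_inj hlen
    have heq' := fFactor_eq.1 heq
    rcases lt_trichotomy t t' with hlt | rfl | hlt
    · exact (cube_inj hlt hy.1 heq').elim
    · rfl
    · exact (cube_inj hlt hx.1 (fun j hj => (heq' j hj).symm)).elim
  have hcard : (D3 1 n : ℤ) = T.card := by
    unfold D3
    rw [hset, Set.InjOn.ncard_image hinj, Set.ncard_coe_finset]
  rw [hcard, Finset.card_sigma, Finset.sum_range_succ]
  simp only [Finset.card_range]
  rw [if_neg (lt_irrefl _)]
  have hsum : ((∑ m ∈ Finset.range g, (if m < g then Nat.fib (m + 1) - 1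
      else n + 1 - (Nat.fib (g + 3) + 3 * Nat.fib (g + 2))) : ℕ) : ℤ) = Nat.fib (g + 2) - 1 - g := by
    rw [← sum_fib_sub, Nat.cast_sum]
    refine Finset.sum_congr rfl fun m hm => ?_
    rw [if_pos (Finset.mem_range.1 hm)]
    have := (fib_bounds m).2.2.1
    omega
  rw [Nat.cast_add, hsum]
  push_cast
  omega
end

section
/- For all integers i ≥ 1 and n ≥ 1, |D(2,i+1,n) − D(2,i,n)| ≤ 1, where D(2,i,n) is the number of distinct squares in F[i;n]. Consequently, for every fixed n and every integer M with min_{i≥1} D(2,i,n) ≤ M ≤ max_{i≥1} D(2,i,n), there exists i₀ ≥ 1 with D(2,i₀,n) = M. -/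
namespace FibSq

/-- the conjugate golden ratio -/
noncomputable def c : ℝ := (1 - √5) / 2

lemma c_sq : c ^ 2 = c + 1 := by
  have h : √5 ^ 2 = 5 := Real.sq_sqrt (by norm_num)
  unfold c; nlinarith

lemma c_lo : -0.6181 < c := by
  have h : √5 < 2.2362 := by rw [Real.sqrt_lt' (by norm_num)]; norm_num
  unfold c; linarith

lemma c_hi : c < -0.618 := by
  have h : 2.236 < √5 := by rw [Real.lt_sqrt (by norm_num)]; norm_num
  unfold c; linarith

lemma pow_c (n : ℕ) : c ^ (n + 1) = Nat.fib (n + 1) * c ^ 2 - ((Nat.fib (n + 1) : ℤ) - (Nat.fib n : ℤ) : ℤ) := by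
  induction n with
  | zero => simp; linarith [c_sq]
  | succ n ih =>
    rw [pow_succ, ih, Nat.fib_add_two]
    push_cast
    have h := c_sq
    rw [h]
    linear_combination (Nat.fib (n + 1) : ℝ) * h

lemma abs_c_lt : |c| < 0.6181 := by
  rw [abs_of_neg (by linarith [c_hi])]; linarith [c_lo]

lemma abs_c_pos : 0 < |c| := by
  rw [abs_of_neg (by linarith [c_hi])]; linarith [c_hi]

lemma abs_c_rel : |c| ^ 2 + |c| = 1 := by
  rw [abs_of_neg (by linarith [c_hi])]; linarith [c_sq]

lemma abs_rec (m : ℕ) : |c| ^ m = |c| ^ (m + 1) + |c| ^ (m + 2) := by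
  have := abs_c_rel
  rw [pow_add, pow_add]
  linear_combination (-(|c| ^ m)) * this

lemma abs_pow_le_one (m : ℕ) : |c| ^ m ≤ 1 :=
  pow_le_one₀ abs_c_pos.le (by linarith [abs_c_lt])

lemma abs_pow_pos (m : ℕ) : 0 < |c| ^ m := pow_pos abs_c_pos m

lemma pow_sign (m : ℕ) : (c ^ m = |c| ^ m ∧ c ^ (m + 1) = -|c| ^ (m + 1)) ∨
    (c ^ m = -|c| ^ m ∧ c ^ (m + 1) = |c| ^ (m + 1)) := by
  have h : |c| = -c := abs_of_neg (by linarith [c_hi])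
  rw [h]
  rcases Nat.even_or_odd m with hm | hm
  · left
    exact ⟨(hm.neg_pow c).symm, by rw [(Even.add_one hm).neg_pow, neg_neg]⟩
  · right
    exact ⟨by rw [hm.neg_pow, neg_neg], by rw [(Odd.add_one hm).neg_pow]⟩

/-- coordinates -/
lemma coords (k d : ℤ) (m : ℕ) : ∃ x y : ℤ, k = x * Nat.fib (m + 2) + y * Nat.fib (m + 1) ∧
    (k : ℝ) * c ^ 2 - d = c ^ (m + 1) * (x * c + y) := by
  induction m with
  | zero =>
    refine ⟨k - d, d, by simp, ?_⟩
    push_cast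
    have := c_sq
    linear_combination (d : ℝ) * this
  | succ m ih =>
    obtain ⟨x, y, h1, h2⟩ := ih
    refine ⟨y, x - y, ?_, ?_⟩
    · rw [h1, show m + 1 + 2 = (m + 1) + 2 from rfl, Nat.fib_add_two (n := m + 1)]
      push_cast; ring
    · rw [h2, pow_succ c (m + 1)]
      push_cast
      have := c_sq
      linear_combination (-(y : ℝ)) * c ^ (m + 1) * this

lemma approx (k d : ℤ) (m : ℕ) (hk : 0 < k) (hk2 : k < Nat.fib (m + 3)) :
    |c| ^ (m + 2) ≤ |(k : ℝ) * c ^ 2 - d| ∧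
    ((Nat.fib (m + 2) : ℤ) < k → |c| ^ m ≤ |(k : ℝ) * c ^ 2 - d|) := by
  obtain ⟨x, y, h1, h2⟩ := coords k d m
  have f1 : (1 : ℤ) ≤ Nat.fib (m + 1) := by exact_mod_cast Nat.fib_pos.2 (by omega)
  have f2 : (Nat.fib (m + 1) : ℤ) ≤ Nat.fib (m + 2) := by exact_mod_cast Nat.fib_le_fib_succ
  have f3 : (Nat.fib (m + 3) : ℤ) = Nat.fib (m + 1) + Nat.fib (m + 2) := by
    exact_mod_cast Nat.fib_add_two (n := m + 1)
  rw [h2, abs_mul, abs_pow]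
  have hr := abs_rec m
  have e0 : |c| ^ m = |c| ^ (m + 1) * (1 - c) := by
    rw [hr, pow_succ _ (m + 1)]
    rw [abs_of_neg (show c < 0 by linarith [c_hi])]; ring
  have e2 : |c| ^ (m + 2) = |c| ^ (m + 1) * (- c) := by
    rw [pow_succ _ (m + 1)]
    rw [abs_of_neg (show c < 0 by linarith [c_hi])]
  rw [e0, e2]
  have hp := (abs_pow_pos (m + 1)).le
  have l1 := c_lo
  have l2 := c_hi
  set A : ℤ := (Nat.fib (m + 1) : ℤ)
  set B : ℤ := (Nat.fib (m + 2) : ℤ)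
  rw [f3] at hk2
  have key : (1 ≤ x ∧ y ≤ 0) ∨ (x ≤ 0 ∧ 1 ≤ y) := by
    by_contra hcon
    push Not at hcon
    rcases le_or_gt x 0 with hx | hx
    · have := hcon.2 hx
      nlinarith
    · have := hcon.1 (by omega)
      nlinarith
  rcases key with ⟨hx, hy⟩ | ⟨hx, hy⟩
  · have hxr : (1 : ℝ) ≤ x := by exact_mod_cast hx
    have hyr : (y : ℝ) ≤ 0 := by exact_mod_cast hy
    refine ⟨mul_le_mul_of_nonneg_left ?_ hp, fun hB => mul_le_mul_of_nonneg_left ?_ hp⟩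
    · rw [abs_of_nonpos (by nlinarith)]; nlinarith
    · have hx2 : 2 ≤ x := by
        by_contra h
        have : x = 1 := by omega
        subst this
        nlinarith
      have hy2 : y ≤ -1 := by
        by_contra h
        have : y = 0 := by omega
        subst this
        nlinarith
      have hxr : (2 : ℝ) ≤ x := by exact_mod_cast hx2
      have hyr : (y : ℝ) ≤ -1 := by exact_mod_cast hy2
      rw [abs_of_nonpos (by nlinarith)]; nlinarith
  · have hxr : (x : ℝ) ≤ 0 := by exact_mod_cast hx
    have hyr : (1 : ℝ) ≤ y := by exact_mod_cast hy
    refine ⟨mul_le_mul_of_nonneg_left ?_ hp, fun hB => mul_le_mul_of_nonneg_left ?_ hp⟩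
    · rw [abs_of_nonneg (by nlinarith)]; nlinarith
    · have hy2 : 2 ≤ y := by
        by_contra h
        have : y = 1 := by omega
        subst this
        nlinarith
      have hyr : (2 : ℝ) ≤ y := by exact_mod_cast hy2
      rw [abs_of_nonneg (by nlinarith)]; nlinarith

lemma gap (t : ℝ) (m : ℕ) : ∃ j : ℕ, j < Nat.fib (m + 2) ∧ ∃ d : ℤ,
    0 ≤ t + j * c ^ 2 - d ∧ t + j * c ^ 2 - d < |c| ^ m := by
  induction m with
  | zero =>
    refine ⟨0, by simp, ⌊t⌋, ?_, ?_⟩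
    · simp
    · have := Int.lt_floor_add_one t
      simp only [Nat.cast_zero, zero_mul, add_zero, pow_zero]; linarith
  | succ m ih =>
    obtain ⟨j, hj, d, h0, h1⟩ := ih
    have r0 := abs_rec m
    have r1 := abs_rec (m + 1)
    have p1 := abs_pow_pos (m + 1)
    have p2 := abs_pow_pos (m + 2)
    have p3 := abs_pow_pos (m + 3)
    have f3 : Nat.fib (m + 1 + 2) = Nat.fib (m + 1) + Nat.fib (m + 2) := Nat.fib_add_two
    have q1 := pow_c m
    have q2 := pow_c (m + 1)
    by_cases hs : t + j * c ^ 2 - d < |c| ^ (m + 1)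
    · exact ⟨j, by omega, d, h0, hs⟩
    push Not at hs
    rcases pow_sign (m + 1) with ⟨s1, s2⟩ | ⟨s1, s2⟩
    · by_cases hjj : Nat.fib (m + 1) ≤ j
      · refine ⟨j - Nat.fib (m + 1), by omega, d - ((Nat.fib (m + 1) : ℤ) - (Nat.fib m : ℤ)), ?_, ?_⟩ <;>
        · push_cast [Nat.cast_sub hjj] at *
          nlinarith
      · refine ⟨j + Nat.fib (m + 2), by omega, d + ((Nat.fib (m + 2) : ℤ) - (Nat.fib (m + 1) : ℤ)), ?_, ?_⟩ <;>
        · push_cast at *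
          nlinarith
    · refine ⟨j + Nat.fib (m + 1), by omega, d + ((Nat.fib (m + 1) : ℤ) - (Nat.fib m : ℤ)), ?_, ?_⟩ <;>
        · push_cast at *
          nlinarith

/-- rotation coding -/
noncomputable def g (t : ℝ) : ℤ := ⌊t + c ^ 2⌋ - ⌊t⌋

lemma al_lo : 0.3819 < c ^ 2 := by rw [c_sq]; linarith [c_lo]
lemma al_hi : c ^ 2 < 0.382 := by rw [c_sq]; linarith [c_hi]

lemma g_cases (t : ℝ) : (g t = 0 ∧ t + c ^ 2 < ⌊t⌋ + 1) ∨ (g t = 1 ∧ ⌊t⌋ + 1 ≤ t + c ^ 2) := by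
  have a1 := al_lo
  have a2 := al_hi
  have h1 := Int.floor_le t
  have h2 := Int.lt_floor_add_one t
  unfold g
  rcases lt_or_ge (t + c ^ 2) (⌊t⌋ + 1) with h | h
  · left
    refine ⟨?_, h⟩
    have : ⌊t + c ^ 2⌋ = ⌊t⌋ := by rw [Int.floor_eq_iff]; constructor <;> linarith
    omega
  · right
    refine ⟨?_, h⟩
    have : ⌊t + c ^ 2⌋ = ⌊t⌋ + 1 := by
      rw [Int.floor_eq_iff]; push_cast; constructor <;> linarith
    omega

lemma g_mid (x y z : ℝ) (h1 : x ≤ y) (h2 : y ≤ z) (h3 : z ≤ x + c ^ 2) : g x = g y ∨ g y = g z := by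
  have a1 := al_lo
  have a2 := al_hi
  have x1 := Int.floor_le x
  have x2 := Int.lt_floor_add_one x
  have y1 := Int.floor_le y
  have y2 := Int.lt_floor_add_one y
  have z1 := Int.floor_le z
  have z2 := Int.lt_floor_add_one z
  have m1 : ⌊x⌋ ≤ ⌊y⌋ := Int.floor_mono h1
  have m2 : ⌊y⌋ ≤ ⌊z⌋ := Int.floor_mono h2
  rcases g_cases x with ⟨gx, hx⟩ | ⟨gx, hx⟩ <;> rcases g_cases y with ⟨gy, hy⟩ | ⟨gy, hy⟩ <;>
    rcases g_cases z with ⟨gz, hz⟩ | ⟨gz, hz⟩ <;> simp only [gx, gy, gz] <;> try simp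
  · have : ⌊z⌋ < ⌊x⌋ + 1 := by
      rw [Int.floor_lt]; push_cast; linarith
    have e1 : ⌊z⌋ = ⌊x⌋ := by omega
    rw [e1] at hz
    have e2 : ⌊y⌋ = ⌊x⌋ := by omega
    rw [e2] at hy
    linarith
  · have : ⌊x⌋ ≠ ⌊y⌋ := by
      intro h; rw [h] at hx; linarith
    have h4 : ⌊x⌋ + 1 ≤ ⌊y⌋ := by omega
    have h5 : ⌊x⌋ + 1 ≤ ⌊z⌋ := by omega
    have h5r : (⌊x⌋ : ℝ) + 1 ≤ ⌊z⌋ := by exact_mod_cast h5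
    linarith

lemma g_mid' (x y z : ℝ) (h : (x ≤ y ∧ y ≤ z) ∨ (z ≤ y ∧ y ≤ x)) (h3 : |z - x| ≤ c ^ 2) :
    g x = g y ∨ g y = g z := by
  rw [abs_le] at h3
  rcases h with h | h
  · exact g_mid x y z h.1 h.2 (by linarith)
  · rcases g_mid z y x h.1 h.2 (by linarith) with h | h
    · right; exact h.symm
    · left; exact h.symm

noncomputable def G (j : ℕ) : Bool := decide (g ((j + 1) * c ^ 2) = 1)

lemma G_eq (j k : ℕ) : G j = G k ↔ g ((j + 1) * c ^ 2) = g ((k + 1) * c ^ 2) := by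
  unfold G
  rcases g_cases ((j + 1) * c ^ 2) with ⟨h, _⟩ | ⟨h, _⟩ <;>
  rcases g_cases ((k + 1) * c ^ 2) with ⟨h', _⟩ | ⟨h', _⟩ <;> simp [h, h']

lemma g_add_int (t : ℝ) (d : ℤ) : g (t + d) = g t := by
  unfold g
  rw [show t + d + c ^ 2 = (t + c ^ 2) + d by ring, Int.floor_add_intCast, Int.floor_add_intCast]
  ring

lemma g_shift (j m : ℕ) : g (((j + Nat.fib (m + 1) : ℕ) + 1) * c ^ 2) = g ((j + 1) * c ^ 2 + c ^ (m + 1)) := by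
  have := pow_c m
  rw [← g_add_int ((j + 1) * c ^ 2 + c ^ (m + 1)) ((Nat.fib (m + 1) : ℤ) - (Nat.fib m : ℤ))]
  congr 1
  push_cast at *
  rw [this]; ring

lemma abs_pow_add (m : ℕ) : |c ^ (m + 2)| ≤ c ^ 2 := by
  rw [pow_add, abs_mul, abs_of_nonneg (sq_nonneg c), abs_pow]
  nlinarith [abs_pow_le_one m, sq_nonneg c]

lemma L1 (j m : ℕ) : G (j + Nat.fib (m + 2)) = G (j + Nat.fib (m + 4)) ∨ G j = G (j + Nat.fib (m + 4)) := by
  rw [G_eq, G_eq, g_shift j (m + 1), g_shift j (m + 3)]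
  have a1 := al_lo
  have a2 := al_hi
  set t : ℝ := (j + 1) * c ^ 2
  have e : c ^ (m + 4) = c ^ (m + 2) * c ^ 2 := by ring
  have hx := abs_pow_add m
  have := g_mid' t (t + c ^ (m + 4)) (t + c ^ (m + 2)) ?_ (by simpa using hx)
  · rcases this with h | h
    · right; exact h
    · left; exact h.symm
  · rw [e]
    rcases le_total 0 (c ^ (m + 2)) with h | h
    · left; constructor <;> nlinarith
    · right; constructor <;> nlinarith

lemma L2 (j m : ℕ) : G j = G (j + Nat.fib (m + 3)) ∨ G j = G (j + Nat.fib (m + 4)) := by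
  rw [G_eq, G_eq, g_shift j (m + 2), g_shift j (m + 3)]
  set t : ℝ := (j + 1) * c ^ 2
  have e : c ^ (m + 4) - c ^ (m + 3) = c ^ (m + 2) := by
    have := c_sq
    rw [pow_add c m 4, pow_add c m 3, pow_add c m 2]
    linear_combination c ^ m * c ^ 2 * this
  have hx := abs_pow_add m
  have := g_mid' (t + c ^ (m + 3)) t (t + c ^ (m + 4)) ?_ (by rw [← e] at hx; simpa using hx)
  · rcases this with h | h
    · left; exact h.symm
    · right; exact h
  · rcases pow_sign (m + 3) with ⟨s1, s2⟩ | ⟨s1, s2⟩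
    · right
      rw [s1, show m + 4 = m + 3 + 1 from rfl, s2]
      constructor <;> linarith [abs_pow_pos (m + 3), abs_pow_pos (m + 3 + 1)]
    · left
      rw [s1, show m + 4 = m + 3 + 1 from rfl, s2]
      constructor <;> linarith [abs_pow_pos (m + 3), abs_pow_pos (m + 3 + 1)]

lemma exists_level (p : ℕ) (hp : 1 ≤ p) : ∃ m, Nat.fib (m + 2) ≤ p ∧ p < Nat.fib (m + 3) := by
  have hex : ∃ m, p < Nat.fib (m + 3) := ⟨p, lt_of_lt_of_le (by
    have : p < Nat.fib (p + 2) := by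
      clear hp
      induction p with
      | zero => simp
      | succ i ih =>
        have : Nat.fib (i + 3) = Nat.fib (i + 1) + Nat.fib (i + 2) := Nat.fib_add_two
        have h : 0 < Nat.fib (i + 1) := Nat.fib_pos.2 (by omega)
        show i + 1 < Nat.fib (i + 3)
        omega
    exact this) Nat.fib_le_fib_succ⟩
  classical
  refine ⟨Nat.find hex, ?_, Nat.find_spec hex⟩
  rcases Nat.eq_zero_or_pos (Nat.find hex) with h | h
  · rw [h]; simpa using hp
  · have := Nat.find_min hex (m := Nat.find hex - 1) (by omega)
    rw [show Nat.find hex - 1 + 3 = Nat.find hex + 2 by omega] at this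
    omega

lemma L3 (i p : ℕ) (hp : 1 ≤ p) (h : ∀ j, i ≤ j → j < i + p → G j = G (j + p)) :
    ∃ m, p = Nat.fib (m + 2) := by
  obtain ⟨m, h1, h2⟩ := exists_level p hp
  refine ⟨m, ?_⟩
  by_contra hne
  have h3 : Nat.fib (m + 2) < p := by omega
  set T : ℕ → ℤ := fun k => ⌊(k : ℝ) * c ^ 2⌋ with hT
  have hc : ∀ e, e ≤ p → T (i + e + p + 1) - T (i + e + 1) = T (i + p + 1) - T (i + 1) := by
    intro e
    induction e with
    | zero => intro _; simp
    | succ e ih =>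
      intro he
      have ih := ih (by omega)
      have hh := h (i + e) (by omega) (by omega)
      rw [G_eq] at hh
      unfold g at hh
      have e1 : (((i + e : ℕ) : ℝ) + 1) * c ^ 2 + c ^ 2 = ((i + (e + 1) + 1 : ℕ) : ℝ) * c ^ 2 := by
        push_cast; ring
      have e2 : (((i + e + p : ℕ) : ℝ) + 1) * c ^ 2 + c ^ 2 = ((i + (e + 1) + p + 1 : ℕ) : ℝ) * c ^ 2 := by
        push_cast; ring
      have e3 : (((i + e : ℕ) : ℝ) + 1) * c ^ 2 = ((i + e + 1 : ℕ) : ℝ) * c ^ 2 := by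
        push_cast; ring
      have e4 : (((i + e + p : ℕ) : ℝ) + 1) * c ^ 2 = ((i + e + p + 1 : ℕ) : ℝ) * c ^ 2 := by
        push_cast; ring
      rw [e1, e2, e3, e4] at hh
      simp only [hT] at ih ⊢
      omega
  set d := T (i + p + 1) - T (i + 1) with hd
  have ap := (approx p d m (by omega) (by exact_mod_cast h2)).2 (by exact_mod_cast h3)
  have r1 := abs_pow_le_one m
  have flT : ∀ (k : ℕ) (z : ℤ), 0 ≤ (k : ℝ) * c ^ 2 - z → (k : ℝ) * c ^ 2 - z < |c| ^ m → T k = z := by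
    intro k z h0 h1
    simp only [hT]
    rw [Int.floor_eq_iff]
    constructor <;> linarith
  have leT : ∀ k : ℕ, (T k : ℝ) ≤ (k : ℝ) * c ^ 2 := fun k => Int.floor_le _
  push_cast at ap
  rcases le_total 0 ((p : ℝ) * c ^ 2 - d) with hs | hs
  · rw [abs_of_nonneg hs] at ap
    obtain ⟨j, hj, z, z0, z1⟩ := gap ((i + p + 1 : ℕ) * c ^ 2) m
    have ee : ((i + p + 1 : ℕ) : ℝ) * c ^ 2 + j * c ^ 2 = ((i + j + p + 1 : ℕ) : ℝ) * c ^ 2 := by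
      push_cast; ring
    rw [ee] at z0 z1
    have t1 := flT _ _ z0 z1
    have t2 := hc j (by omega)
    have t3 := leT (i + j + 1)
    have t4 : T (i + j + 1) = z - d := by omega
    rw [t4] at t3
    push_cast at *
    nlinarith
  · rw [abs_of_nonpos hs] at ap
    obtain ⟨j, hj, z, z0, z1⟩ := gap ((i + 1 : ℕ) * c ^ 2) m
    have ee : ((i + 1 : ℕ) : ℝ) * c ^ 2 + j * c ^ 2 = ((i + j + 1 : ℕ) : ℝ) * c ^ 2 := by
      push_cast; ring
    rw [ee] at z0 z1
    have t1 := flT _ _ z0 z1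
    have t2 := hc j (by omega)
    have t3 := leT (i + j + p + 1)
    have t4 : T (i + j + p + 1) = z + d := by omega
    rw [t4] at t3
    push_cast at *
    nlinarith

lemma floor_val (k : ℕ) (z : ℤ) (h1 : (z : ℝ) ≤ k * c ^ 2) (h2 : k * c ^ 2 < z + 1) :
    ⌊(k : ℝ) * c ^ 2⌋ = z := by
  rw [Int.floor_eq_iff]; exact ⟨h1, h2⟩

lemma G_def (j : ℕ) : G j = decide (⌊((j + 2 : ℕ) : ℝ) * c ^ 2⌋ - ⌊((j + 1 : ℕ) : ℝ) * c ^ 2⌋ = 1) := by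
  unfold G g
  rw [show ((j : ℝ) + 1) * c ^ 2 + c ^ 2 = ((j + 2 : ℕ) : ℝ) * c ^ 2 by push_cast; ring,
    show ((j : ℝ) + 1) * c ^ 2 = ((j + 1 : ℕ) : ℝ) * c ^ 2 by push_cast; ring]

lemma G_small : G 0 = false ∧ G 1 = true ∧ G 2 = false ∧ G 3 = false ∧ G 4 = true := by
  have a1 := al_lo
  have a2 := al_hi
  have v1 := floor_val 1 0 (by push_cast; linarith) (by push_cast; linarith)
  have v2 := floor_val 2 0 (by push_cast; linarith) (by push_cast; linarith)
  have v3 := floor_val 3 1 (by push_cast; linarith) (by push_cast; linarith)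
  have v4 := floor_val 4 1 (by push_cast; linarith) (by push_cast; linarith)
  have v5 := floor_val 5 1 (by push_cast; linarith) (by push_cast; linarith)
  have v6 := floor_val 6 2 (by push_cast; linarith) (by push_cast; linarith)
  simp only [G_def, Nat.reduceAdd, v1, v2, v3, v4, v5, v6]
  decide

lemma G_per (m j : ℕ) (hm : 2 ≤ m) (hj : j < Nat.fib (m + 2)) : G (Nat.fib (m + 3) + j) = G j := by
  rw [add_comm, G_eq, g_shift j (m + 2)]
  have fl : ∀ k : ℕ, 0 < k → k ≤ Nat.fib (m + 2) + 1 →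
      ⌊(k : ℝ) * c ^ 2 + c ^ (m + 3)⌋ = ⌊(k : ℝ) * c ^ 2⌋ := by
    intro k hk0 hk
    have f3 : Nat.fib (m + 3) = Nat.fib (m + 1) + Nat.fib (m + 2) := Nat.fib_add_two
    have f4 : Nat.fib 3 ≤ Nat.fib (m + 1) := Nat.fib_mono (by omega)
    have f5 : Nat.fib 3 = 2 := rfl
    have k2 : k < Nat.fib (m + 3) := by omega
    have h1 := (approx k ⌊(k : ℝ) * c ^ 2⌋ m (by omega) (by exact_mod_cast k2)).1
    have h2 := (approx k (⌊(k : ℝ) * c ^ 2⌋ + 1) m (by omega) (by exact_mod_cast k2)).1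
    have b1 := Int.floor_le ((k : ℝ) * c ^ 2)
    have b2 := Int.lt_floor_add_one ((k : ℝ) * c ^ 2)
    push_cast at h1 h2
    rw [abs_of_nonneg (a := (k : ℝ) * c ^ 2 - _) (by linarith)] at h1
    rw [abs_of_nonpos (a := (k : ℝ) * c ^ 2 - _) (by linarith)] at h2
    have r := abs_rec (m + 2)
    have p4 := abs_pow_pos (m + 4)
    have b : |c ^ (m + 3)| = |c| ^ (m + 3) := abs_pow _ _
    have b3 := le_abs_self (c ^ (m + 3))
    have b4 := neg_abs_le (c ^ (m + 3))
    rw [Int.floor_eq_iff]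
    constructor <;> linarith
  unfold g
  have x1 := fl (j + 1) (by omega) (by omega)
  have x2 := fl (j + 2) (by omega) (by omega)
  push_cast at x1 x2
  rw [x1, show ((j : ℝ) + 1) * c ^ 2 + c ^ (m + 2 + 1) + c ^ 2 = (j + 2) * c ^ 2 + c ^ (m + 3) by ring, x2]
  rw [show ((j : ℝ) + 1) * c ^ 2 + c ^ 2 = (j + 2) * c ^ 2 by ring]

lemma Fw_eq (m : ℕ) : Fw m = (List.range (Nat.fib (m + 2))).map G ∧
    Fw (m + 1) = (List.range (Nat.fib (m + 3))).map G := by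
  obtain ⟨g0, g1, g2, g3, g4⟩ := G_small
  have n2 : Nat.fib 2 = 1 := rfl
  have n3 : Nat.fib 3 = 2 := rfl
  have n4 : Nat.fib 4 = 3 := rfl
  have n5 : Nat.fib 5 = 5 := rfl
  induction m with
  | zero => simp [Fw, n2, n3, List.range_succ, g0, g1]
  | succ m ih =>
    refine ⟨ih.2, ?_⟩
    match m, ih with
    | 0, _ => simp [Fw, n4, List.range_succ, g0, g1, g2]
    | 1, _ => simp [Fw, n5, List.range_succ, g0, g1, g2, g3, g4]
    | m + 2, ih =>
      rw [show m + 2 + 1 + 1 = (m + 2) + 2 from rfl, Fw, ih.1, ih.2]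
      rw [show Nat.fib (m + 2 + 1 + 3) = Nat.fib (m + 2 + 3) + Nat.fib (m + 2 + 2) by
        rw [add_comm (Nat.fib (m + 2 + 3))]; exact Nat.fib_add_two]
      rw [List.range_add, List.map_append, List.map_map]
      congr 1
      apply List.map_congr_left
      intro j hj
      rw [List.mem_range] at hj
      exact (G_per (m + 2) j (by omega) hj).symm

lemma lt_fib (i : ℕ) : i < Nat.fib (i + 2) := by
  induction i with
  | zero => simp
  | succ i ih =>
    have : Nat.fib (i + 3) = Nat.fib (i + 1) + Nat.fib (i + 2) := Nat.fib_add_two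
    have h : 0 < Nat.fib (i + 1) := Nat.fib_pos.2 (by omega)
    show i + 1 < Nat.fib (i + 3)
    omega

lemma fibWord_eq (i : ℕ) : fibWord i = G i := by
  unfold fibWord
  rw [(Fw_eq i).2]
  have h : i < Nat.fib (i + 3) := lt_of_lt_of_le (lt_fib i) Nat.fib_le_fib_succ
  simp [List.getD, h]

/-- abstract properties of a window of length `N` -/
structure Good (W : ℕ → Bool) (N : ℕ) : Prop where
  l1 : ∀ m j, j + Nat.fib (m + 4) < N →
    W (j + Nat.fib (m + 2)) = W (j + Nat.fib (m + 4)) ∨ W j = W (j + Nat.fib (m + 4))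
  l2 : ∀ m j, j + Nat.fib (m + 4) < N →
    W j = W (j + Nat.fib (m + 3)) ∨ W j = W (j + Nat.fib (m + 4))
  l3 : ∀ s p, 1 ≤ p → s + 2 * p ≤ N → (∀ t < p, W (s + t) = W (s + t + p)) →
    ∃ m, p = Nat.fib (m + 2)

/-- reversed window -/
def rev (W : ℕ → Bool) (N t : ℕ) : Bool := W (N - 1 - t)

/-- periods of prefix squares of the window that do not recur in the window -/
def T (W : ℕ → Bool) (N : ℕ) : Set ℕ :=
  {p | 1 ≤ p ∧ 2 * p ≤ N ∧ (∀ t < p, W t = W (t + p)) ∧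
    ∀ s, 1 ≤ s → s + 2 * p ≤ N → ∃ t < 2 * p, W (s + t) ≠ W t}

lemma good_fib (i N : ℕ) : Good (fun t => fibWord (i + t)) N where
  l1 := by
    intro m j _
    simp only [fibWord_eq, ← add_assoc]
    exact L1 (i + j) m
  l2 := by
    intro m j _
    simp only [fibWord_eq, ← add_assoc]
    exact L2 (i + j) m
  l3 := by
    intro s p hp _ h
    apply L3 (i + s) p hp
    intro j h1 h2
    have := h (j - (i + s)) (by omega)
    simp only [fibWord_eq] at this
    rw [show i + (s + (j - (i + s))) = j by omega,
      show i + (s + (j - (i + s)) + p) = j + p by omega] at this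
    exact this

lemma Good.rev {W : ℕ → Bool} {N : ℕ} (h : Good W N) : Good (rev W N) N where
  l1 := by
    intro m j hj
    have f : Nat.fib (m + 4) = Nat.fib (m + 2) + Nat.fib (m + 3) := Nat.fib_add_two
    have := h.l2 m (N - 1 - (j + Nat.fib (m + 4))) (by omega)
    unfold FibSq.rev
    rw [show N - 1 - (j + Nat.fib (m + 4)) + Nat.fib (m + 4) = N - 1 - j by omega,
      show N - 1 - (j + Nat.fib (m + 4)) + Nat.fib (m + 3) = N - 1 - (j + Nat.fib (m + 2)) by omega] at this
    rcases this with h | h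
    · left; exact h.symm
    · right; exact h.symm
  l2 := by
    intro m j hj
    have f : Nat.fib (m + 4) = Nat.fib (m + 2) + Nat.fib (m + 3) := Nat.fib_add_two
    have := h.l1 m (N - 1 - (j + Nat.fib (m + 4))) (by omega)
    unfold FibSq.rev
    rw [show N - 1 - (j + Nat.fib (m + 4)) + Nat.fib (m + 4) = N - 1 - j by omega,
      show N - 1 - (j + Nat.fib (m + 4)) + Nat.fib (m + 2) = N - 1 - (j + Nat.fib (m + 3)) by omega] at this
    rcases this with h | h
    · left; exact h.symm
    · right; exact h.symm
  l3 := by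
    intro s p hp hs hh
    apply h.l3 (N - s - 2 * p) p hp (by omega)
    intro t ht
    have := hh (p - 1 - t) (by omega)
    unfold FibSq.rev at this
    rw [show N - 1 - (s + (p - 1 - t)) = N - s - 2 * p + t + p by omega,
      show N - 1 - (s + (p - 1 - t) + p) = N - s - 2 * p + t by omega] at this
    exact this.symm

lemma T_sub {W W' : ℕ → Bool} {N : ℕ} (h : ∀ t < N, W t = W' t) : T W N ⊆ T W' N := by
  rintro p ⟨h1, h2, h3, h4⟩
  refine ⟨h1, h2, fun t ht => ?_, fun s hs hs2 => ?_⟩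
  · rw [← h t (by omega), ← h (t + p) (by omega)]; exact h3 t ht
  · obtain ⟨t, ht, hne⟩ := h4 s hs hs2
    refine ⟨t, ht, ?_⟩
    rw [← h t (by omega), ← h (s + t) (by omega)]; exact hne

lemma T_rev_rev (W : ℕ → Bool) (N : ℕ) : T (rev (rev W N) N) N = T W N := by
  have h : ∀ t < N, rev (rev W N) N t = W t := by
    intro t ht
    unfold rev
    congr 1; omega
  exact subset_antisymm (T_sub h) (T_sub fun t ht => (h t ht).symm)

lemma T_fin (W : ℕ → Bool) (N : ℕ) : (T W N).Finite :=
  (Set.finite_Iic N).subset (by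
    rintro p ⟨_, h2, _⟩
    simp only [Set.mem_Iic]; omega)

lemma main {W : ℕ → Bool} {N : ℕ} (h : Good W N) {p q : ℕ} (hp : p ∈ T W N) (hq : q ∈ T W N)
    (hpq : p < q) : (∃ m, p = Nat.fib (m + 2) ∧ q = Nat.fib (m + 3)) ∧ q ∈ T (rev W N) N := by
  obtain ⟨p1, p2, p3, p4⟩ := hp
  obtain ⟨q1, q2, q3, q4⟩ := hq
  have lt2 : q < 2 * p := by
    by_contra hcon
    obtain ⟨t, ht, hne⟩ := p4 q (by omega) (by omega)
    apply hne
    rw [q3 t (by omega), add_comm]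
  obtain ⟨m, hm⟩ := h.l3 0 p p1 (by omega) (by simpa using p3)
  obtain ⟨k, hk⟩ := h.l3 0 q q1 (by omega) (by simpa using q3)
  have f4 : Nat.fib (m + 4) = Nat.fib (m + 2) + Nat.fib (m + 3) := Nat.fib_add_two
  have f23 : Nat.fib (m + 2) ≤ Nat.fib (m + 3) := Nat.fib_le_fib_succ
  have hkm : k = m + 1 := by
    rcases Nat.lt_trichotomy k (m + 1) with h | h | h
    · have : Nat.fib (k + 2) ≤ Nat.fib (m + 2) := Nat.fib_mono (by omega)
      omega
    · exact h
    · have : Nat.fib (m + 4) ≤ Nat.fib (k + 2) := Nat.fib_mono (by omega)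
      omega
  subst hkm
  replace hk : q = Nat.fib (m + 3) := hk
  have f4' : Nat.fib (m + 4) = p + q := by omega
  have per : ∀ t < 2 * p, t + q < N → W t = W (t + q) := by
    intro t ht htN
    by_cases htq : t < q
    · exact q3 t htq
    have := h.l1 m (t - p) (by omega)
    rw [f4', ← hm, show t - p + p = t by omega, show t - p + (p + q) = t + q by omega] at this
    rcases this with h | h
    · exact h
    · have := p3 (t - p) (by omega)
      rw [show t - p + p = t by omega] at this
      rw [← this, h]
  have hN : N < q + 2 * p := by
    by_contra hcon
    obtain ⟨t, ht, hne⟩ := p4 q (by omega) (by omega)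
    apply hne
    rw [per t ht (by omega), add_comm]
  have per' : ∀ t, t + q < N → W t = W (t + q) := fun t ht => per t (by omega) ht
  refine ⟨⟨m, hm, hk⟩, q1, q2, ?_, ?_⟩
  · intro t ht
    unfold rev
    rw [per' (N - 1 - (t + q)) (by omega)]
    congr 1; omega
  · intro s hs hsN
    by_contra hcon
    push Not at hcon
    have hx : ∀ x, N ≤ x + s + 2 * q → x + s < N → W x = W (x + s) := by
      intro x hx1 hx2
      have := hcon (N - 1 - s - x) (by omega)
      unfold rev at this
      rw [show N - 1 - (s + (N - 1 - s - x)) = x by omega,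
        show N - 1 - (N - 1 - s - x) = x + s by omega] at this
      exact this
    obtain ⟨t, ht, hne⟩ := q4 s hs hsN
    apply hne
    by_cases hc : N ≤ t + s + 2 * q
    · rw [hx t hc (by omega), add_comm]
    · rw [per' t (by omega), per' (s + t) (by omega), hx (t + q) (by omega) (by omega)]
      congr 1; omega

lemma fib_inj {a b : ℕ} (h : Nat.fib (a + 2) = Nat.fib (b + 2)) : a = b :=
  Nat.fib_add_two_strictMono.injective h

lemma no_three {W : ℕ → Bool} {N : ℕ} (h : Good W N) {p q r : ℕ} (hp : p ∈ T W N) (hq : q ∈ T W N)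
    (hr : r ∈ T W N) (h1 : p < q) (h2 : q < r) : False := by
  obtain ⟨⟨m, m1, m2⟩, _⟩ := main h hp hq h1
  obtain ⟨⟨k, k1, k2⟩, _⟩ := main h hq hr h2
  obtain ⟨⟨l, l1, l2⟩, _⟩ := main h hp hr (h1.trans h2)
  have e1 : m = l := fib_inj (m1.symm.trans l1)
  subst e1
  omega

lemma card_le {W : ℕ → Bool} {N : ℕ} (h : Good W N) : (T W N).ncard ≤ 2 := by
  by_contra hcon
  push Not at hcon
  rw [Set.two_lt_ncard (T_fin W N)] at hcon
  obtain ⟨a, ha, b, hb, d, hd, h1, h2, h3⟩ := hcon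
  rcases Nat.lt_or_gt_of_ne h1 with x | x <;> rcases Nat.lt_or_gt_of_ne h2 with y | y <;>
    rcases Nat.lt_or_gt_of_ne h3 with z | z
  · exact no_three h ha hb hd x z
  · exact no_three h ha hd hb y z
  · omega
  · exact no_three h hd ha hb y x
  · exact no_three h hb ha hd x y
  · omega
  · exact no_three h hb hd ha z y
  · exact no_three h hd hb ha z x

lemma card_two {W : ℕ → Bool} {N : ℕ} (h : Good W N) (h2 : 2 ≤ (T W N).ncard) :
    1 ≤ (T (rev W N) N).ncard := by
  obtain ⟨a, b, ha, hb, hab⟩ := (Set.one_lt_ncard_iff (T_fin W N)).1 h2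
  have : (T (rev W N) N).Nonempty := by
    rcases Nat.lt_or_gt_of_ne hab with x | x
    · exact ⟨_, (main h ha hb x).2⟩
    · exact ⟨_, (main h hb ha x).2⟩
  exact (Set.ncard_pos (T_fin _ N)).2 this

/-- roots of squares inside the part `[lo, hi)` of `W` -/
def B (W : ℕ → Bool) (lo hi : ℕ) : Set (List Bool) :=
  {w | ∃ s p, 1 ≤ p ∧ lo ≤ s ∧ s + 2 * p ≤ hi ∧ w = (List.range p).map (fun t => W (s + t)) ∧
    ∀ t < p, W (s + t) = W (s + t + p)}

lemma map_range_inj {f h : ℕ → Bool} {p q : ℕ}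
    (e : (List.range p).map f = (List.range q).map h) : p = q ∧ ∀ t < p, f t = h t := by
  have hl : p = q := by simpa using congrArg List.length e
  subst hl
  refine ⟨rfl, fun t ht => ?_⟩
  exact (List.map_inj_left.1 e) t (List.mem_range.2 ht)

lemma map_range_congr {f h : ℕ → Bool} {p : ℕ} (e : ∀ t < p, f t = h t) :
    (List.range p).map f = (List.range p).map h :=
  List.map_congr_left fun t ht => e t (List.mem_range.1 ht)

lemma B_fin (W : ℕ → Bool) (lo hi : ℕ) : (B W lo hi).Finite := by
  have : (Set.image2 (fun s p => (List.range p).map (fun t => W (s + t)))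
      (Set.Iic hi) (Set.Iic hi)).Finite := (Set.finite_Iic hi).image2 _ (Set.finite_Iic hi)
  refine this.subset ?_
  rintro w ⟨s, p, h1, h2, h3, rfl, _⟩
  exact ⟨s, by simp only [Set.mem_Iic]; omega, p, by simp only [Set.mem_Iic]; omega, rfl⟩

lemma E1 (W : ℕ → Bool) (N : ℕ) :
    B W 0 N \ B W 1 N = (fun p => (List.range p).map W) '' T W N := by
  ext w
  constructor
  · rintro ⟨⟨s, p, h1, h2, h3, rfl, h5⟩, hn⟩
    have hs : s = 0 := by
      by_contra hs
      exact hn ⟨s, p, h1, by omega, h3, rfl, h5⟩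
    subst hs
    simp only [zero_add] at *
    refine ⟨p, ⟨h1, h3, h5, ?_⟩, rfl⟩
    intro s hs hsN
    by_contra hcon
    push Not at hcon
    apply hn
    refine ⟨s, p, h1, hs, hsN, map_range_congr fun t ht => (hcon t (by omega)).symm, ?_⟩
    intro t ht
    rw [hcon t (by omega), add_assoc, hcon (t + p) (by omega), h5 t ht]
  · rintro ⟨p, ⟨h1, h2, h3, h4⟩, rfl⟩
    refine ⟨⟨0, p, h1, le_rfl, by omega, by simp, by simpa using h3⟩, ?_⟩
    rintro ⟨s, q, k1, k2, k3, k4, k5⟩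
    obtain ⟨rfl, e⟩ := map_range_inj k4
    obtain ⟨t, ht, hne⟩ := h4 s k2 k3
    apply hne
    by_cases htp : t < p
    · exact (e t htp).symm
    · have a := k5 (t - p) (by omega)
      have b := h3 (t - p) (by omega)
      have d := e (t - p) (by omega)
      rw [show s + (t - p) + p = s + t by omega] at a
      rw [show t - p + p = t by omega] at b
      rw [← a, ← b, d]

lemma E2 (W : ℕ → Bool) (n : ℕ) :
    B W 0 (n + 1) \ B W 0 n =
      (fun p => (List.range p).map (fun t => W (n + 1 - 2 * p + t))) '' T (rev W (n + 1)) (n + 1) := by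
  ext w
  constructor
  · rintro ⟨⟨s, p, h1, h2, h3, rfl, h5⟩, hn⟩
    have hs : s = n + 1 - 2 * p := by
      by_contra hs
      exact hn ⟨s, p, h1, by omega, by omega, rfl, h5⟩
    subst hs
    refine ⟨p, ⟨h1, by omega, ?_, ?_⟩, rfl⟩
    · intro t ht
      have := h5 (p - 1 - t) (by omega)
      unfold rev
      rw [show n + 1 - 1 - t = n + 1 - 2 * p + (p - 1 - t) + p by omega,
        show n + 1 - 1 - (t + p) = n + 1 - 2 * p + (p - 1 - t) by omega]
      exact this.symm
    intro s hs hsN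
    by_contra hcon
    push Not at hcon
    have hx : ∀ x < 2 * p, W (n + 1 - 2 * p - s + x) = W (n + 1 - 2 * p + x) := by
      intro x hx
      have := hcon (2 * p - 1 - x) (by omega)
      unfold rev at this
      rw [show n + 1 - 1 - (s + (2 * p - 1 - x)) = n + 1 - 2 * p - s + x by omega,
        show n + 1 - 1 - (2 * p - 1 - x) = n + 1 - 2 * p + x by omega] at this
      exact this
    apply hn
    refine ⟨n + 1 - 2 * p - s, p, h1, by omega, by omega,
      map_range_congr fun t ht => (hx t (by omega)).symm, ?_⟩
    intro t ht
    rw [hx t (by omega), add_assoc, hx (t + p) (by omega), h5 t ht, add_assoc]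
  · rintro ⟨p, ⟨h1, h2, h3, h4⟩, rfl⟩
    have h3' : ∀ t < p, W (n + 1 - 2 * p + t) = W (n + 1 - 2 * p + t + p) := by
      intro t ht
      have := h3 (p - 1 - t) (by omega)
      unfold rev at this
      rw [show n + 1 - 1 - (p - 1 - t) = n + 1 - 2 * p + t + p by omega,
        show n + 1 - 1 - (p - 1 - t + p) = n + 1 - 2 * p + t by omega] at this
      exact this.symm
    refine ⟨⟨n + 1 - 2 * p, p, h1, by omega, by omega, rfl, h3'⟩, ?_⟩
    rintro ⟨s, q, k1, k2, k3, k4, k5⟩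
    obtain ⟨rfl, e⟩ := map_range_inj k4
    obtain ⟨t', ht', hne⟩ := h4 (n + 1 - 2 * p - s) (by omega) (by omega)
    apply hne
    unfold rev
    obtain ⟨t, rfl⟩ : ∃ t, t' = 2 * p - 1 - t := ⟨2 * p - 1 - t', by omega⟩
    have key : ∀ t < 2 * p, W (s + t) = W (n + 1 - 2 * p + t) := by
      intro t ht
      by_cases htp : t < p
      · exact (e t htp).symm
      · have a := k5 (t - p) (by omega)
        have b := h3' (t - p) (by omega)
        have d := e (t - p) (by omega)
        rw [show s + (t - p) + p = s + t by omega] at a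
        rw [show n + 1 - 2 * p + (t - p) + p = n + 1 - 2 * p + t by omega] at b
        rw [← a, ← b, d]
    have := key (2 * p - 1 - (2 * p - 1 - t)) (by omega)
    rw [show s + (2 * p - 1 - (2 * p - 1 - t)) =
        n + 1 - 1 - (n + 1 - 2 * p - s + (2 * p - 1 - t)) by omega,
      show n + 1 - 2 * p + (2 * p - 1 - (2 * p - 1 - t)) = n + 1 - 1 - (2 * p - 1 - t) by omega] at this
    exact this

lemma card_diff {W : ℕ → Bool} {n : ℕ} (h : Good W (n + 1)) :
    |((B W 1 (n + 1)).ncard : ℤ) - (B W 0 n).ncard| ≤ 1 := by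
  have s1 : B W 1 (n + 1) ⊆ B W 0 (n + 1) := by
    rintro w ⟨s, p, h1, h2, h3⟩
    exact ⟨s, p, h1, by omega, h3⟩
  have s2 : B W 0 n ⊆ B W 0 (n + 1) := by
    rintro w ⟨s, p, h1, h2, h3, h4⟩
    exact ⟨s, p, h1, h2, by omega, h4⟩
  have c1 := Set.ncard_sdiff_add_ncard_of_subset s1 (B_fin W 0 (n + 1))
  have c2 := Set.ncard_sdiff_add_ncard_of_subset s2 (B_fin W 0 (n + 1))
  rw [E1, Set.ncard_image_of_injective _ (fun p q e => (map_range_inj e).1)] at c1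
  rw [E2, Set.ncard_image_of_injective _ (fun p q e => (map_range_inj e).1)] at c2
  have a1 := card_le h
  have a2 := card_le h.rev
  have b1 := card_two h
  have b2 := card_two h.rev
  rw [T_rev_rev] at b2
  rw [abs_le]
  omega

lemma infix_iff (i n : ℕ) (w : List Bool) : (w ≠ [] ∧ (w ++ w) <:+: fFactor i n) ↔
    ∃ s p, 1 ≤ p ∧ s + 2 * p ≤ n ∧ w = (List.range p).map (fun t => fibWord (i - 1 + (s + t))) ∧
      ∀ t < p, fibWord (i - 1 + (s + t)) = fibWord (i - 1 + (s + t + p)) := by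
  have hl : (fFactor i n).length = n := by simp [fFactor]
  have hg : ∀ k, k < n → (fFactor i n)[k]? = some (fibWord (i - 1 + k)) := by
    intro k hk
    simp [fFactor, hk]
  rw [List.infix_iff_getElem?, hl]
  constructor
  · rintro ⟨hw, k, hk, hh⟩
    have hpos := List.length_pos_of_ne_nil hw
    simp only [List.length_append] at hk hh
    have h1 : ∀ t (ht : t < w.length), fibWord (i - 1 + (k + t)) = w[t] := by
      intro t ht
      have := hh t (by omega)
      rw [hg _ (by omega), List.getElem_append_left ht] at this
      rw [add_comm k t]
      exact Option.some.inj this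
    have h2 : ∀ t (ht : t < w.length), fibWord (i - 1 + (k + t + w.length)) = w[t] := by
      intro t ht
      have := hh (t + w.length) (by omega)
      rw [hg _ (by omega), List.getElem_append_right (by omega)] at this
      simp only [Nat.add_sub_cancel] at this
      rw [show k + t + w.length = t + w.length + k by omega]
      exact Option.some.inj this
    refine ⟨k, w.length, hpos, by omega, ?_, fun t ht => by rw [h1 t ht, h2 t ht]⟩
    apply List.ext_getElem (by simp)
    intro t ht _
    simp [h1 t ht]
  · rintro ⟨s, p, hp, hs, rfl, hh⟩
    refine ⟨by simp; omega, s, by simp; omega, ?_⟩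
    intro t ht
    simp only [List.length_append, List.length_map, List.length_range] at ht
    rw [hg _ (by omega)]
    congr 1
    by_cases htp : t < p
    · rw [List.getElem_append_left (by simpa using htp)]
      simp [add_comm]
    · rw [List.getElem_append_right (by simpa using htp)]
      have := hh (t - p) (by omega)
      rw [show s + (t - p) + p = t + s by omega] at this
      simp [this]

lemma D2_a (i n : ℕ) : D2 i n = (B (fun t => fibWord (i - 1 + t)) 0 n).ncard := by
  unfold D2 B
  congr 1
  ext w
  simp only [Set.mem_ofPred_eq]
  rw [infix_iff]
  simp

lemma D2_b (i n : ℕ) (hi : 1 ≤ i) :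
    D2 (i + 1) n = (B (fun t => fibWord (i - 1 + t)) 1 (n + 1)).ncard := by
  unfold D2 B
  congr 1
  ext w
  simp only [Set.mem_ofPred_eq]
  rw [infix_iff]
  constructor
  · rintro ⟨s, p, h1, h2, h3, h4⟩
    refine ⟨s + 1, p, h1, by omega, by omega, ?_, ?_⟩
    · rw [h3]
      apply map_range_congr
      intro t _
      congr 1; omega
    · intro t ht
      have := h4 t ht
      rw [show i + 1 - 1 + (s + t) = i - 1 + (s + 1 + t) by omega,
        show i + 1 - 1 + (s + t + p) = i - 1 + (s + 1 + t + p) by omega] at this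
      exact this
  · rintro ⟨s, p, h1, h0, h2, h3, h4⟩
    refine ⟨s - 1, p, h1, by omega, ?_, ?_⟩
    · rw [h3]
      apply map_range_congr
      intro t _
      congr 1; omega
    · intro t ht
      have := h4 t ht
      rw [show i + 1 - 1 + (s - 1 + t) = i - 1 + (s + t) by omega,
        show i + 1 - 1 + (s - 1 + t + p) = i - 1 + (s + t + p) by omega]
      exact this

lemma step (i n : ℕ) (hi : 1 ≤ i) : |(D2 (i + 1) n : ℤ) - (D2 i n : ℤ)| ≤ 1 := by
  rw [D2_b i n hi, D2_a i n]
  exact card_diff (good_fib (i - 1) (n + 1))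

lemma ivt (f : ℕ → ℕ) (a M : ℕ) (hf : ∀ k, a ≤ k → |(f (k + 1) : ℤ) - (f k : ℤ)| ≤ 1) (d : ℕ) :
    ((f a ≤ M ∧ M ≤ f (a + d)) ∨ (f (a + d) ≤ M ∧ M ≤ f a)) → ∃ k, a ≤ k ∧ f k = M := by
  induction d with
  | zero => intro h; exact ⟨a, le_rfl, by simp at h; omega⟩
  | succ d ih =>
    intro h
    by_cases hd : (f a ≤ M ∧ M ≤ f (a + d)) ∨ (f (a + d) ≤ M ∧ M ≤ f a)
    · exact ih hd
    · refine ⟨a + (d + 1), by omega, ?_⟩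
      have := hf (a + d) (by omega)
      rw [abs_le, show a + d + 1 = a + (d + 1) by omega] at this
      omega

end FibSq

/-- `|D(2,i+1,n) - D(2,i,n)| ≤ 1`; consequently `D(2,·,n)` attains every intermediate
value between its minimum and its maximum over `i ≥ 1`. -/
theorem squares_count_intermediate_values :
    (∀ i n : ℕ, 1 ≤ i → 1 ≤ n → |(D2 (i + 1) n : ℤ) - (D2 i n : ℤ)| ≤ 1) ∧
    (∀ n M : ℕ,
      sInf {d : ℕ | ∃ i, 1 ≤ i ∧ D2 i n = d} ≤ M →
      M ≤ sSup {d : ℕ | ∃ i, 1 ≤ i ∧ D2 i n = d} →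
      ∃ i₀, 1 ≤ i₀ ∧ D2 i₀ n = M) := by
  refine ⟨fun i n hi _ => FibSq.step i n hi, ?_⟩
  intro n M h1 h2
  set S : Set ℕ := {d : ℕ | ∃ i, 1 ≤ i ∧ D2 i n = d} with hS
  have hne : S.Nonempty := ⟨D2 1 n, 1, le_rfl, rfl⟩
  obtain ⟨a, ha, hae⟩ : sInf S ∈ S := Nat.sInf_mem hne
  by_cases hb : BddAbove S
  · obtain ⟨b, hb, hbe⟩ : sSup S ∈ S := Nat.sSup_mem hne hb
    rcases le_total a b with hab | hab
    · obtain ⟨k, hk, hke⟩ := FibSq.ivt (fun i => D2 i n) a M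
        (fun k hk => FibSq.step k n (by omega)) (b - a)
        (Or.inl (by rw [Nat.add_sub_cancel' hab]; exact ⟨by simpa [hae] using h1, by simpa [hbe] using h2⟩))
      exact ⟨k, by omega, hke⟩
    · obtain ⟨k, hk, hke⟩ := FibSq.ivt (fun i => D2 i n) b M
        (fun k hk => FibSq.step k n (by omega)) (a - b)
        (Or.inr (by rw [Nat.add_sub_cancel' hab]; exact ⟨by simpa [hae] using h1, by simpa [hbe] using h2⟩))
      exact ⟨k, by omega, hke⟩
  · rw [Nat.sSup_of_not_bddAbove hb] at h2
    exact ⟨a, ha, by omega⟩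
end
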